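/- arXiv:1806.10849 — 2 statements merged into one kernel-verified Lean document; each statement's English description precedes it below -/
import Mathlib

section
/- Let 1 ≤ p < ∞. Then lim_{d→∞} ∫_{𝕋^d} |(z_1 + z_2 + ⋯ + z_d)/√d|^p dμ_d(z) = Γ(1 + p/2). Equivalently, the p-th absolute moments of the normalized sums (z_1 + ⋯ + z_d)/√d of independent uniformly distributed points on the unit circle converge to the p-th absolute moment ∫_ℂ |Z|^p e^{-|Z|²} dZ/π of the standard complex normal distribution. -/
open MeasureTheory Complex Filter
open scoped ENNReal NNReal

noncomputable instance : MeasurableSpace Circle := borel Circle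
instance : BorelSpace Circle := ⟨rfl⟩

/-- The normalized Lebesgue arc measure on the unit circle, i.e. its Haar probability
measure. -/
noncomputable def muCircle : Measure Circle := Measure.haarMeasure ⊤

instance : IsProbabilityMeasure muCircle :=
  ⟨by simpa [muCircle] using
    Measure.haarMeasure_self (K₀ := (⊤ : TopologicalSpace.PositiveCompacts Circle))⟩

/-- The probability measure `μ_d` on `𝕋^d`: the product of normalized Lebesgue arc
measures. -/
noncomputable def muD (d : ℕ) : Measure (Fin d → Circle) := Measure.pi fun _ => muCircle

open scoped InnerProductSpace

section WeakConvergence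

variable {Ω : Type*} [MeasurableSpace Ω]

/-- Truncating a function at height `M` changes its integral by at most the second
moment divided by `M`. -/
lemma abs_integral_sub_integral_min_le {μ : Measure Ω} [IsFiniteMeasure μ] {f : Ω → ℝ} {M C : ℝ}
    (hf : Measurable f) (hM : 0 < M) (hint : Integrable (fun x => f x ^ 2) μ)
    (hC : ∫ x, f x ^ 2 ∂μ ≤ C) :
    |∫ x, f x ∂μ - ∫ x, min (f x) M ∂μ| ≤ C / M := by
  have hf1 : Integrable f μ :=
    ((memLp_two_iff_integrable_sq hf.aestronglyMeasurable).2 hint).integrable (by norm_num)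
  have hmin : Integrable (fun x => min (f x) M) μ := hf1.inf (integrable_const M)
  rw [← integral_sub hf1 hmin, abs_of_nonneg
    (integral_nonneg fun x => sub_nonneg.2 (min_le_left _ _))]
  calc ∫ x, (f x - min (f x) M) ∂μ ≤ ∫ x, f x ^ 2 / M ∂μ := by
        refine integral_mono (hf1.sub hmin) (hint.div_const M) fun x => ?_
        rw [le_div_iff₀ hM]
        rcases le_total (f x) M with h | h
        · simp [h, sq_nonneg]
        · simp only [min_eq_right h]
          nlinarith [sq_nonneg (f x), sq_nonneg (f x - M)]
    _ ≤ C / M := by rw [integral_div]; gcongr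

/-- Integrals of a continuous nonnegative function with uniformly bounded second moments converge
along a weakly convergent sequence of probability measures. -/
lemma tendsto_integral_of_tendsto_of_sq_le [TopologicalSpace Ω] [OpensMeasurableSpace Ω]
    {ν : ℕ → ProbabilityMeasure Ω} {μ : ProbabilityMeasure Ω}
    (hν : Tendsto ν atTop (nhds μ)) {f : Ω → ℝ} (hf : Continuous f) (hf0 : ∀ x, 0 ≤ f x) {C : ℝ}
    (hνint : ∀ n, Integrable (fun x => f x ^ 2) (ν n : Measure Ω))
    (hνC : ∀ n, ∫ x, f x ^ 2 ∂(ν n : Measure Ω) ≤ C)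
    (hμint : Integrable (fun x => f x ^ 2) (μ : Measure Ω)) :
    Tendsto (fun n => ∫ x, f x ∂(ν n : Measure Ω)) atTop (nhds (∫ x, f x ∂(μ : Measure Ω))) := by
  set D : ℝ := max C (∫ x, f x ^ 2 ∂(μ : Measure Ω))
  have hD0 : 0 ≤ D := (integral_nonneg fun x => sq_nonneg (f x)).trans (le_max_right _ _)
  rw [Metric.tendsto_atTop]
  intro ε hε
  set M : ℝ := 3 * (D + 1) / ε with hM
  have hM0 : 0 < M := by positivity
  have hDM : D / M < ε / 3 := by
    rw [div_lt_iff₀ hM0, hM]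
    field_simp
    linarith
  let g : BoundedContinuousFunction Ω ℝ :=
    BoundedContinuousFunction.ofNormedAddCommGroup (fun x => min (f x) M)
      (hf.min continuous_const) M fun x => by
        rw [Real.norm_eq_abs, abs_of_nonneg (le_min (hf0 x) hM0.le)]
        exact min_le_right _ _
  obtain ⟨N, hN⟩ := Metric.tendsto_atTop.1
    ((ProbabilityMeasure.tendsto_iff_forall_integral_tendsto.1 hν) g) (ε / 3) (by positivity)
  refine ⟨N, fun n hn => ?_⟩
  have h1 := abs_le.1 (abs_integral_sub_integral_min_le hf.measurable hM0 (hνint n)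
    ((hνC n).trans (le_max_left _ _ : C ≤ D)))
  have h2 := abs_le.1 (abs_integral_sub_integral_min_le hf.measurable hM0 hμint
    (le_max_right _ _ : _ ≤ D))
  have h3 := hN n hn
  rw [Real.dist_eq, abs_lt] at h3 ⊢
  change -(ε / 3) < ∫ x, min (f x) M ∂(ν n : Measure Ω) - ∫ x, min (f x) M ∂(μ : Measure Ω) ∧
    ∫ x, min (f x) M ∂(ν n : Measure Ω) - ∫ x, min (f x) M ∂(μ : Measure Ω) < ε / 3 at h3
  constructor <;> linarith [h1.1, h1.2, h2.1, h2.2, h3.1, h3.2]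

end WeakConvergence

section ComplexGaussian

/-- The standard complex normal distribution, with density `π⁻¹ exp (-|z|²)`. -/
noncomputable def stdComplexGaussian : Measure ℂ :=
  volume.withDensity fun z => ENNReal.ofReal (Real.pi⁻¹ * Real.exp (-‖z‖ ^ 2))

lemma integral_stdComplexGaussian {E : Type*} [NormedAddCommGroup E] [NormedSpace ℝ E]
    (f : ℂ → E) :
    ∫ z, f z ∂stdComplexGaussian = ∫ z : ℂ, (Real.pi⁻¹ * Real.exp (-‖z‖ ^ 2)) • f z := by
  rw [stdComplexGaussian, integral_withDensity_eq_integral_toReal_smul (by fun_prop)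
    (by simp)]
  refine integral_congr_ae (.of_forall fun z => ?_)
  simp only
  rw [ENNReal.toReal_ofReal (by positivity)]

/-- The absolute moments of the standard complex normal distribution. -/
lemma integral_norm_rpow_stdComplexGaussian {q : ℝ} (hq : -2 < q) :
    ∫ z, ‖z‖ ^ q ∂stdComplexGaussian = Real.Gamma (1 + q / 2) := by
  have h := Complex.integral_rpow_mul_exp_neg_rpow (p := 2) one_le_two hq
  simp only [Real.rpow_two] at h
  have h' : ∀ z : ℂ, (Real.pi⁻¹ * Real.exp (-‖z‖ ^ 2)) • ‖z‖ ^ q =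
      Real.pi⁻¹ * (‖z‖ ^ q * Real.exp (-‖z‖ ^ 2)) := fun z => by rw [smul_eq_mul]; ring
  rw [integral_stdComplexGaussian]
  simp_rw [h']
  rw [integral_const_mul, h, show (q + 2) / 2 = 1 + q / 2 by ring]
  field_simp

lemma integrable_norm_rpow_stdComplexGaussian {q : ℝ} (hq : -2 < q) :
    Integrable (fun z : ℂ => ‖z‖ ^ q) stdComplexGaussian := by
  refine Integrable.of_integral_ne_zero ?_
  rw [integral_norm_rpow_stdComplexGaussian hq]
  exact (Real.Gamma_pos_of_pos (by linarith)).ne'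

instance : IsProbabilityMeasure stdComplexGaussian := by
  have h : ∫ _, (1 : ℝ) ∂stdComplexGaussian = 1 := by
    simpa using integral_norm_rpow_stdComplexGaussian (q := 0) (by norm_num)
  rw [integral_const, smul_eq_mul, mul_one] at h
  exact ⟨(ENNReal.toReal_eq_one_iff _).1 h⟩

lemma charFun_stdComplexGaussian (t : ℂ) :
    charFun stdComplexGaussian t = cexp (-‖t‖ ^ 2 / 4) := by
  have h := GaussianFourier.integral_cexp_neg_mul_sq_norm_add (V := ℂ) (b := 1) (by simp) I t
  have h' : ∀ z : ℂ, (Real.pi⁻¹ * Real.exp (-‖z‖ ^ 2)) • cexp (⟪z, t⟫_ℝ * I) =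
      (Real.pi : ℂ)⁻¹ * cexp (-1 * ‖z‖ ^ 2 + I * ⟪t, z⟫_ℝ) := fun z => by
    rw [Complex.exp_add, real_inner_comm, Complex.real_smul]
    push_cast
    rw [mul_comm I, neg_one_mul]
    ring
  rw [charFun_apply, integral_stdComplexGaussian]
  simp_rw [h']
  rw [integral_const_mul, h, Complex.finrank_real_complex]
  have hpi : (Real.pi : ℂ) ≠ 0 := by exact_mod_cast Real.pi_ne_zero
  simp [hpi]

end ComplexGaussian

section Circle

instance : Measure.IsMulLeftInvariant muCircle := by
  unfold muCircle; infer_instance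

lemma integrable_pi_circle_of_continuous {d : ℕ}
    {f : (Fin d → Circle) → ℝ} (hf : Continuous f) :
    Integrable f (muD d) := by
  unfold muD
  exact hf.integrable_of_hasCompactSupport (HasCompactSupport.of_compactSpace f)

instance (d : ℕ) : IsProbabilityMeasure (muD d) := by
  unfold muD; infer_instance

lemma continuous_inner_circle (t : ℂ) : Continuous fun z : Circle => ⟪t, (z : ℂ)⟫_ℝ := by
  fun_prop

lemma integrable_circle_of_continuous {f : Circle → ℝ} (hf : Continuous f) :
    Integrable f muCircle :=
  hf.integrable_of_hasCompactSupport (HasCompactSupport.of_compactSpace f)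

lemma integral_inner_circle (t : ℂ) : ∫ z : Circle, ⟪t, (z : ℂ)⟫_ℝ ∂muCircle = 0 := by
  have h := integral_mul_left_eq_self (μ := muCircle) (fun z : Circle => ⟪t, (z : ℂ)⟫_ℝ)
    (Circle.exp Real.pi)
  simp only [Circle.coe_mul, Circle.coe_exp, Complex.exp_pi_mul_I, neg_one_mul, inner_neg_right,
    integral_neg] at h
  linarith

lemma integral_inner_circle_sq (t : ℂ) :
    ∫ z : Circle, ⟪t, (z : ℂ)⟫_ℝ ^ 2 ∂muCircle = ‖t‖ ^ 2 / 2 := by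
  have h := integral_mul_left_eq_self (μ := muCircle) (fun z : Circle => ⟪t, (z : ℂ)⟫_ℝ ^ 2)
    (Circle.exp (Real.pi / 2))
  have hsum : ∫ z : Circle, (⟪t, ((Circle.exp (Real.pi / 2) * z : Circle) : ℂ)⟫_ℝ ^ 2
      + ⟪t, (z : ℂ)⟫_ℝ ^ 2) ∂muCircle = ‖t‖ ^ 2 := by
    have hpt : ∀ z : Circle, ⟪t, ((Circle.exp (Real.pi / 2) * z : Circle) : ℂ)⟫_ℝ ^ 2
        + ⟪t, (z : ℂ)⟫_ℝ ^ 2 = ‖t‖ ^ 2 := fun z => by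
      have hz : (z : ℂ).re * (z : ℂ).re + (z : ℂ).im * (z : ℂ).im = 1 := by
        rw [← Complex.normSq_apply, Circle.normSq_coe]
      have he : ((Circle.exp (Real.pi / 2) : Circle) : ℂ) = I := by
        simp [Circle.coe_exp, Complex.exp_pi_div_two_mul_I]
      rw [Circle.coe_mul, he, ← Complex.normSq_eq_norm_sq, Complex.normSq_apply]
      simp only [Complex.inner, Complex.mul_re, Complex.mul_im, Complex.conj_re, Complex.conj_im,
        Complex.I_re, Complex.I_im]
      linear_combination (t.re * t.re + t.im * t.im) * hz
    simp_rw [hpt]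
    simp
  rw [integral_add (integrable_circle_of_continuous (by fun_prop))
    (integrable_circle_of_continuous (by fun_prop)), h] at hsum
  linarith

/-- The normalized sum `(z_1 + ⋯ + z_d)/√d`. -/
noncomputable def normalizedSum (d : ℕ) (z : Fin d → Circle) : ℂ :=
  (∑ j, (z j : ℂ)) / (Real.sqrt d : ℂ)

@[fun_prop]
lemma continuous_normalizedSum (d : ℕ) : Continuous (normalizedSum d) := by
  unfold normalizedSum
  fun_prop

lemma inner_normalizedSum (d : ℕ) (t : ℂ) (z : Fin d → Circle) :
    ⟪t, normalizedSum d z⟫_ℝ = ∑ j, (√(d : ℝ))⁻¹ * ⟪t, (z j : ℂ)⟫_ℝ := by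
  have : normalizedSum d z = (√(d : ℝ))⁻¹ • ∑ j, (z j : ℂ) := by
    rw [normalizedSum, Complex.real_smul, div_eq_inv_mul]
    push_cast
    rfl
  rw [this, inner_smul_right, inner_sum, Finset.mul_sum]

lemma integral_exp_inner_normalizedSum_le (d : ℕ) (t : ℂ) :
    ∫ z, Real.exp ⟪t, normalizedSum d z⟫_ℝ ∂muD d ≤ Real.exp (‖t‖ ^ 2 / 2) := by
  have hsub : ProbabilityTheory.HasSubgaussianMGF (fun z : Circle => ⟪t, (z : ℂ)⟫_ℝ) _ muCircle :=
    ProbabilityTheory.hasSubgaussianMGF_of_mem_Icc_of_integral_eq_zero (a := -‖t‖) (b := ‖t‖)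
      (continuous_inner_circle t).aemeasurable
      (.of_forall fun z => abs_le.1 ((abs_real_inner_le_norm t (z : ℂ)).trans_eq
        (by rw [Circle.norm_coe, mul_one])))
      (integral_inner_circle t)
  have hmgf := hsub.mgf_le (√(d : ℝ))⁻¹
  have hc : (((‖‖t‖ - -‖t‖‖₊ / 2) ^ 2 : ℝ≥0) : ℝ) = ‖t‖ ^ 2 := by
    simp [← two_mul]
  rw [hc] at hmgf
  simp_rw [inner_normalizedSum, Real.exp_sum]
  rw [muD, integral_fintype_prod_eq_pow
    (fun z : Circle => Real.exp ((√(d : ℝ))⁻¹ * ⟪t, (z : ℂ)⟫_ℝ)), Fintype.card_fin]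
  calc _ ≤ Real.exp (‖t‖ ^ 2 * (√(d : ℝ))⁻¹ ^ 2 / 2) ^ d :=
        pow_le_pow_left₀ (integral_nonneg fun _ => (Real.exp_pos _).le) hmgf d
    _ ≤ Real.exp (‖t‖ ^ 2 / 2) := by
        rw [← Real.exp_nat_mul, Real.exp_le_exp, inv_pow, Real.sq_sqrt (Nat.cast_nonneg d)]
        rcases eq_or_ne d 0 with rfl | hd
        · simp; positivity
        · have : (d : ℝ) ≠ 0 := by exact_mod_cast hd
          field_simp
          exact le_refl _

lemma norm_rpow_le_sum_exp_inner {q : ℝ} (hq : 0 ≤ q) (w : ℂ) :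
    ‖w‖ ^ q ≤ Real.exp ⟪((2 * q : ℝ) : ℂ), w⟫_ℝ + Real.exp ⟪((-(2 * q) : ℝ) : ℂ), w⟫_ℝ +
      Real.exp ⟪((2 * q : ℝ) : ℂ) * I, w⟫_ℝ + Real.exp ⟪((-(2 * q) : ℝ) : ℂ) * I, w⟫_ℝ := by
  have h1 : ‖w‖ ^ q ≤ Real.exp (q * (|w.re| + |w.im|)) :=
    calc ‖w‖ ^ q ≤ Real.exp ‖w‖ ^ q := by
          gcongr
          linarith [Real.add_one_le_exp ‖w‖]
      _ = Real.exp (q * ‖w‖) := by rw [← Real.exp_mul, mul_comm]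
      _ ≤ _ := by gcongr; exact Complex.norm_le_abs_re_add_abs_im w
  have h2 : ∀ x : ℝ, Real.exp (2 * q * |x|) ≤ Real.exp (2 * q * x) + Real.exp (-(2 * q) * x) := by
    intro x
    rcases abs_cases x with ⟨h, -⟩ | ⟨h, -⟩ <;> rw [h]
    · linarith [Real.exp_pos (-(2 * q) * x)]
    · rw [show 2 * q * -x = -(2 * q) * x by ring]
      linarith [Real.exp_pos (2 * q * x)]
  have h3 : Real.exp (q * (|w.re| + |w.im|)) ≤
      Real.exp (2 * q * |w.re|) + Real.exp (2 * q * |w.im|) := by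
    rcases le_total |w.re| |w.im| with h | h
    · refine le_add_of_nonneg_of_le (Real.exp_pos _).le (Real.exp_le_exp.2 ?_)
      nlinarith
    · refine le_add_of_le_of_nonneg (Real.exp_le_exp.2 ?_) (Real.exp_pos _).le
      nlinarith
  have e1 : ∀ c : ℝ, ⟪(c : ℂ), w⟫_ℝ = c * w.re := fun c => by simp [Complex.inner]; ring
  have e2 : ∀ c : ℝ, ⟪(c : ℂ) * I, w⟫_ℝ = c * w.im := fun c => by simp [Complex.inner]; ring
  rw [e1, e1, e2, e2]
  linarith [h2 w.re, h2 w.im]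

lemma integral_norm_normalizedSum_rpow_le {q : ℝ} (hq : 0 ≤ q) (d : ℕ) :
    ∫ z, ‖normalizedSum d z‖ ^ q ∂muD d ≤ 4 * Real.exp ((2 * q) ^ 2 / 2) := by
  have hint : ∀ t : ℂ, Integrable (fun z => Real.exp ⟪t, normalizedSum d z⟫_ℝ) (muD d) :=
    fun t => integrable_pi_circle_of_continuous (by fun_prop)
  have hint₂ : ∀ t₁ t₂ : ℂ, Integrable (fun z => Real.exp ⟪t₁, normalizedSum d z⟫_ℝ +
      Real.exp ⟪t₂, normalizedSum d z⟫_ℝ) (muD d) := fun t₁ t₂ => (hint t₁).add (hint t₂)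
  have hint₃ : ∀ t₁ t₂ t₃ : ℂ, Integrable (fun z => Real.exp ⟪t₁, normalizedSum d z⟫_ℝ +
      Real.exp ⟪t₂, normalizedSum d z⟫_ℝ + Real.exp ⟪t₃, normalizedSum d z⟫_ℝ) (muD d) :=
    fun t₁ t₂ t₃ => (hint₂ t₁ t₂).add (hint t₃)
  refine (integral_mono (integrable_pi_circle_of_continuous ?_)
    ((hint₃ _ _ _).add (hint _))
    fun z => norm_rpow_le_sum_exp_inner hq (normalizedSum d z)).trans ?_
  · exact (continuous_normalizedSum d).norm.rpow_const fun _ => Or.inr hq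
  · simp only [Pi.add_apply]
    rw [integral_add (hint₃ _ _ _) (hint _), integral_add (hint₂ _ _) (hint _),
      integral_add (hint _) (hint _)]
    have h : ∀ t : ℂ, ‖t‖ ^ 2 = (2 * q) ^ 2 →
        ∫ z, Real.exp ⟪t, normalizedSum d z⟫_ℝ ∂muD d ≤ Real.exp ((2 * q) ^ 2 / 2) :=
      fun t ht => ht ▸ integral_exp_inner_normalizedSum_le d t
    have h1 := h ((2 * q : ℝ) : ℂ) (by rw [Complex.norm_real]; simp [abs_of_nonneg hq])
    have h2 := h ((-(2 * q) : ℝ) : ℂ) (by rw [Complex.norm_real]; simp [abs_of_nonneg hq])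
    have h3 := h (((2 * q : ℝ) : ℂ) * I)
      (by rw [norm_mul, Complex.norm_real]; simp [abs_of_nonneg hq])
    have h4 := h (((-(2 * q) : ℝ) : ℂ) * I)
      (by rw [norm_mul, Complex.norm_real]; simp [abs_of_nonneg hq])
    linarith

/-- The law of the normalized sum `(z_1 + ⋯ + z_d)/√d`. -/
noncomputable def normalizedSumLaw (d : ℕ) : ProbabilityMeasure ℂ :=
  ⟨(muD d).map (normalizedSum d),
    Measure.isProbabilityMeasure_map (continuous_normalizedSum d).aemeasurable⟩

lemma integral_normalizedSumLaw {E : Type*} [NormedAddCommGroup E] [NormedSpace ℝ E] (d : ℕ)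
    {f : ℂ → E} (hf : StronglyMeasurable f) :
    ∫ w, f w ∂(normalizedSumLaw d : Measure ℂ) = ∫ z, f (normalizedSum d z) ∂muD d :=
  integral_map (continuous_normalizedSum d).aemeasurable hf.aestronglyMeasurable

lemma charFun_normalizedSumLaw (d : ℕ) (t : ℂ) (c : ℝ) (hc : c ≠ 0) :
    charFun (normalizedSumLaw d : Measure ℂ) t =
      charFun (muCircle.map fun z : Circle => c * ⟪t, (z : ℂ)⟫_ℝ) ((√(d : ℝ))⁻¹ * c⁻¹) ^ d := by
  rw [charFun_apply, charFun_apply_real, integral_normalizedSumLaw d (by fun_prop),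
    integral_map (by fun_prop) (by fun_prop)]
  have h : ∀ z, cexp (⟪normalizedSum d z, t⟫_ℝ * I) = ∏ j,
      cexp (((√(d : ℝ))⁻¹ * c⁻¹ : ℝ) * (c * ⟪t, (z j : ℂ)⟫_ℝ : ℝ) * I) := fun z => by
    rw [real_inner_comm, inner_normalizedSum, ← Complex.exp_sum, ← Finset.sum_mul]
    congr 2
    push_cast
    refine Finset.sum_congr rfl fun j _ => ?_
    have : (c : ℂ) ≠ 0 := by exact_mod_cast hc
    field_simp
  simp_rw [h]
  rw [muD, integral_fintype_prod_eq_pow (fun z : Circle =>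
    cexp (((√(d : ℝ))⁻¹ * c⁻¹ : ℝ) * (c * ⟪t, (z : ℂ)⟫_ℝ : ℝ) * I)), Fintype.card_fin]

/-- The central limit theorem for normalized sums of independent uniform points on the circle. -/
lemma tendsto_normalizedSumLaw :
    Tendsto normalizedSumLaw atTop (nhds (⟨stdComplexGaussian, inferInstance⟩ :
      ProbabilityMeasure ℂ)) := by
  refine ProbabilityMeasure.tendsto_of_tendsto_charFun fun t => ?_
  change Tendsto _ _ (nhds (charFun stdComplexGaussian t))
  rcases eq_or_ne t 0 with rfl | ht
  · simp
  have ht' : ‖t‖ ≠ 0 := norm_ne_zero_iff.2 ht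
  set c : ℝ := √2 / ‖t‖ with hc
  have hc0 : c ≠ 0 := by positivity
  have hc2 : c ^ 2 * (‖t‖ ^ 2 / 2) = 1 := by
    rw [hc, div_pow, Real.sq_sqrt zero_le_two]
    field_simp
  simp_rw [fun d => charFun_normalizedSumLaw d t c hc0]
  rw [charFun_stdComplexGaussian]
  convert ProbabilityTheory.tendsto_charFun_inv_sqrt_mul_pow (P := muCircle)
    (X := fun z : Circle => c * ⟪t, (z : ℂ)⟫_ℝ) (by fun_prop) ?_ ?_ c⁻¹ using 2
  · have : c⁻¹ ^ 2 = ‖t‖ ^ 2 / 2 := by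
      rw [inv_pow]; exact inv_eq_of_mul_eq_one_right hc2
    rw [← Complex.ofReal_pow c⁻¹, this]
    push_cast
    ring_nf
  · rw [integral_const_mul, integral_inner_circle, mul_zero]
  · simp only [Pi.pow_apply, mul_pow]
    rw [integral_const_mul, integral_inner_circle_sq, hc2]

end Circle

/-- the `p`-th absolute moments of `(z_1 + ⋯ + z_d)/√d` converge to
`Γ(1 + p/2)`, the `p`-th absolute moment of the standard complex normal distribution. -/
theorem moments_tendsto_gamma (p : ℝ) (hp : 1 ≤ p) :
    Tendsto (fun d : ℕ =>
        ∫ z : Fin d → Circle, ‖(∑ j, (z j : ℂ)) / (Real.sqrt d : ℂ)‖ ^ p ∂muD d)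
      atTop (nhds (Real.Gamma (1 + p / 2))) := by
  have hsq : ∀ w : ℂ, (‖w‖ ^ p) ^ 2 = ‖w‖ ^ (p * 2) := fun w => by
    rw [Real.rpow_mul (norm_nonneg w), Real.rpow_two]
  have hcont : ∀ {q : ℝ}, 0 ≤ q → Continuous fun w : ℂ => ‖w‖ ^ q := fun hq =>
    continuous_norm.rpow_const fun _ => Or.inr hq
  have hp0 : 0 ≤ p := by linarith
  have hp2 : 0 ≤ p * 2 := by linarith
  have h := tendsto_integral_of_tendsto_of_sq_le tendsto_normalizedSumLaw (hcont hp0)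
    (fun w => by positivity) (C := 4 * Real.exp ((2 * (p * 2)) ^ 2 / 2))
    (fun d => ?_) (fun d => ?_) ?_
  · simp only [fun d => integral_normalizedSumLaw d (hcont hp0).stronglyMeasurable] at h
    rw [← integral_norm_rpow_stdComplexGaussian (by linarith)]
    exact h
  · simp_rw [hsq]
    exact (integrable_map_measure (hcont hp2).aestronglyMeasurable
      (continuous_normalizedSum d).aemeasurable).2
      (integrable_pi_circle_of_continuous ((hcont hp2).comp (continuous_normalizedSum d)))
  · simp_rw [hsq]
    rw [integral_normalizedSumLaw d (hcont hp2).stronglyMeasurable]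
    exact integral_norm_normalizedSum_rpow_le hp2 d
  · simp_rw [hsq]
    exact integrable_norm_rpow_stdComplexGaussian (by linarith)
end

section
/- Let 1 < p < ∞, set φ(z) = z_1 + z_2 on 𝕋², and define ψ(z) = 2 · ‖φ‖_{L^p(𝕋²)}^{-p} · |φ(z)|^{p-2} φ(z). Then for every k ∈ ℤ, ∫_{𝕋²} ψ(z) · conj(z_1)^k · conj(z_2)^{1-k} dμ_2(z) = Γ(1+p/2) Γ(p/2) · (1/Γ(1+p/2-k)) · (1/Γ(p/2+k)), where 1/Γ denotes the reciprocal Gamma function, taken to be 0 at nonpositive integers; here conj(z)^m for negative m means conj(z)^m = z^{-m}. In particular, ψ(e^{iθ_1}, e^{iθ_2}) has the Fourier series Σ_{k∈ℤ} [Γ(1+p/2)Γ(p/2)/(Γ(1+p/2-k)Γ(p/2+k))] e^{ikθ_1} e^{i(1-k)θ_2}. -/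
open MeasureTheory Complex Filter
open scoped ENNReal NNReal

/-- `φ(z) = z_1 + ⋯ + z_d` on `𝕋^d`. -/
noncomputable def phiD (d : ℕ) : (Fin d → Circle) → ℂ := fun z => ∑ j, (z j : ℂ)

/-- The `L^p(𝕋^d)` norm of `φ`. -/
noncomputable def phiNorm (p : ℝ) (d : ℕ) : ℝ :=
  (∫ z : Fin d → Circle, ‖phiD d z‖ ^ p ∂muD d) ^ (1 / p)

/-- The extremal function `ψ(z) = d ‖φ‖_p^{-p} |φ(z)|^{p-2} φ(z)`. -/
noncomputable def psiFn (p : ℝ) (d : ℕ) : (Fin d → Circle) → ℂ := fun z =>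
  ((d * (phiNorm p d) ^ (-p) : ℝ) : ℂ) * ((‖phiD d z‖ ^ (p - 2) : ℝ) : ℂ) * phiD d z

instance : muCircle.IsHaarMeasure := by unfold muCircle; infer_instance

instance inst_s16 (d : ℕ) : IsProbabilityMeasure (muD d) := by unfold muD; infer_instance

instance (d : ℕ) : (muD d).IsMulLeftInvariant := by unfold muD; infer_instance

instance (d : ℕ) : (muD d).IsOpenPosMeasure := by unfold muD; infer_instance

lemma integrable_muD_of_continuous {d : ℕ} {f : (Fin d → Circle) → ℂ} (hf : Continuous f) :
    Integrable f (muD d) :=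
  hf.integrable_of_hasCompactSupport (HasCompactSupport.of_compactSpace f)

lemma continuous_norm_rpow_sub_two_mul {p : ℝ} (hp : 1 < p) :
    Continuous fun x : ℂ => ((‖x‖ ^ (p - 2) : ℝ) : ℂ) * x := by
  rw [continuous_iff_continuousAt]
  intro x
  by_cases hx : x = 0
  · subst hx
    have hn : ∀ y : ℂ, ‖((‖y‖ ^ (p - 2) : ℝ) : ℂ) * y‖ = ‖y‖ ^ (p - 1) := by
      intro y
      by_cases hy : y = 0
      · simp [hy, Real.zero_rpow (by linarith : p - 1 ≠ 0)]
      · have h : 0 < ‖y‖ := norm_pos_iff.2 hy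
        rw [norm_mul, Complex.norm_real, Real.norm_of_nonneg (by positivity),
          show p - 1 = (p - 2) + 1 by ring, Real.rpow_add_one h.ne']
    have hc : Continuous fun y : ℂ => ‖y‖ ^ (p - 1) :=
      continuous_norm.rpow_const fun _ => Or.inr (by linarith)
    rw [ContinuousAt, mul_zero, tendsto_zero_iff_norm_tendsto_zero]
    simp only [hn]
    simpa [Real.zero_rpow (by linarith : p - 1 ≠ 0)] using hc.tendsto 0
  · have : ContinuousAt (fun y : ℂ => ‖y‖ ^ (p - 2)) x :=
      continuous_norm.continuousAt.rpow_const (Or.inl (norm_ne_zero_iff.2 hx))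
    exact (Complex.continuous_ofReal.continuousAt.comp this).mul continuousAt_id

lemma continuous_phiD (d : ℕ) : Continuous (phiD d) := by
  unfold phiD
  fun_prop

lemma continuous_coe_apply_zpow {d : ℕ} (j : Fin d) (m : ℤ) :
    Continuous fun z : Fin d → Circle => (z j : ℂ) ^ m :=
  (continuous_subtype_val.comp (continuous_apply j)).zpow₀ m fun _ => Or.inl (Circle.coe_ne_zero _)

/-- The function `|φ|^{p-2} φ z_1^m z_2^n` on `𝕋²`. -/
noncomputable def powTwist (p : ℝ) (m n : ℤ) (z : Fin 2 → Circle) : ℂ :=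
  ((‖phiD 2 z‖ ^ (p - 2) : ℝ) : ℂ) * phiD 2 z * (z 0 : ℂ) ^ m * (z 1 : ℂ) ^ n

lemma continuous_powTwist {p : ℝ} (hp : 1 < p) (m n : ℤ) : Continuous (powTwist p m n) :=
  (((continuous_norm_rpow_sub_two_mul hp).comp (continuous_phiD 2)).mul
    (continuous_coe_apply_zpow 0 m)).mul (continuous_coe_apply_zpow 1 n)

/-- `|φ|^p` multiplied by a character decomposes through `|φ|^p = |φ|^{p-2} φ conj(φ)`. -/
lemma norm_phiD_rpow_mul {p : ℝ} (hp : 1 < p) (k : ℤ) (z : Fin 2 → Circle) :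
    ((‖phiD 2 z‖ ^ p : ℝ) : ℂ) * (z 0 : ℂ) ^ (-k) * (z 1 : ℂ) ^ k
      = powTwist p (-k) (k - 1) z + powTwist p (-(k + 1)) k z := by
  have h0 := Circle.coe_ne_zero (z 0)
  have h1 := Circle.coe_ne_zero (z 1)
  have hφ : phiD 2 z = z 0 + z 1 := by simp [phiD]
  have hn : ((‖phiD 2 z‖ ^ p : ℝ) : ℂ)
      = ((‖phiD 2 z‖ ^ (p - 2) : ℝ) : ℂ) * phiD 2 z * ((z 0 : ℂ)⁻¹ + (z 1 : ℂ)⁻¹) := by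
    have hconj : (z 0 : ℂ)⁻¹ + (z 1 : ℂ)⁻¹ = (starRingEnd ℂ) (phiD 2 z) := by
      rw [hφ, map_add, ← Circle.coe_inv_eq_conj, ← Circle.coe_inv_eq_conj, Circle.coe_inv,
        Circle.coe_inv]
    rw [hconj, mul_assoc, Complex.mul_conj, Complex.normSq_eq_norm_sq, ← Complex.ofReal_mul]
    congr 1
    by_cases h : phiD 2 z = 0
    · simp [h, Real.zero_rpow (by linarith : p ≠ 0)]
    · rw [← Real.rpow_natCast, ← Real.rpow_add (norm_pos_iff.2 h)]
      norm_num
  rw [hn, powTwist, powTwist, zpow_sub_one₀ h1, neg_add, ← sub_eq_add_neg, zpow_sub_one₀ h0]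
  ring

/-- The derivative at `t` of `|φ|^p z_1^{-k} z_2^k` along the rotation `z_1 ↦ e^{it} z_1`. -/
lemma hasDerivAt_rotation {p : ℝ} (hp : 1 < p) (k : ℤ) (z : Fin 2 → Circle) (t : ℝ) :
    HasDerivAt (fun s : ℝ => ((‖phiD 2 (![Circle.exp s, 1] * z)‖ ^ p : ℝ) : ℂ)
        * (((![Circle.exp s, 1] * z) 0 : Circle) : ℂ) ^ (-k)
        * (((![Circle.exp s, 1] * z) 1 : Circle) : ℂ) ^ k)
      (I * ((p / 2 - k) * powTwist p (-k) (k - 1) (![Circle.exp t, 1] * z)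
        - (p / 2 + k) * powTwist p (-(k + 1)) k (![Circle.exp t, 1] * z))) t := by
  have he : HasDerivAt (fun s : ℝ => ((Circle.exp s : Circle) : ℂ) * (z 0 : ℂ))
      (I * (Circle.exp t * z 0)) t := by
    simp only [Circle.coe_exp]
    have h := (((hasDerivAt_id t).ofReal_comp.mul_const I).cexp).mul_const (z 0 : ℂ)
    refine h.congr_deriv ?_
    simp
    ring
  set w := ![Circle.exp t, 1] * z with hw
  have hw0 : (w 0 : ℂ) = Circle.exp t * z 0 := by simp [hw]
  have hw1 : (w 1 : ℂ) = z 1 := by simp [hw]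
  have hφ : ∀ s : ℝ, phiD 2 (![Circle.exp s, 1] * z) = Circle.exp s * z 0 + z 1 := by
    intro s
    simp [phiD]
  have h0 := Circle.coe_ne_zero (w 0)
  have h1 := Circle.coe_ne_zero (w 1)
  have hnorm := ((hasFDerivAt_norm_rpow (phiD 2 w) hp).comp_hasDerivAt_of_eq t
    (he.add_const (z 1 : ℂ)) (hφ t)).ofReal_comp
  have hpow := (hasDerivAt_zpow (-k) (w 0 : ℂ) (Or.inl h0)).comp_of_eq t he hw0.symm
  have hprod := (hnorm.mul hpow).mul_const ((z 1 : ℂ) ^ k)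
  have hconj : ∀ u : Circle, (starRingEnd ℂ) (u : ℂ) = (u : ℂ)⁻¹ := fun u => by
    rw [← Circle.coe_inv_eq_conj, Circle.coe_inv]
  have hinner : ((inner ℝ (phiD 2 w) (I * (w 0 : ℂ)) : ℝ) : ℂ)
      = I / 2 * (phiD 2 w * ((w 1 : ℂ)⁻¹ - (w 0 : ℂ)⁻¹)) := by
    rw [Complex.inner, Complex.re_eq_add_conj, show phiD 2 w = w 0 + w 1 by simp [phiD]]
    simp only [map_mul, map_add, map_inv₀, hconj, Complex.conj_I, inv_inv]
    field_simp
    ring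
  have hmul := norm_phiD_rpow_mul hp k w
  refine (hprod.congr_of_eventuallyEq ?_).congr_deriv ?_
  · refine Eventually.of_forall fun s => ?_
    simp [hφ]
  · have hφw : (w 0 : ℂ) + z 1 = phiD 2 w := by rw [hw0, ← hφ t]
    have e1 : powTwist p (-k) (k - 1) w = ((‖phiD 2 w‖ ^ (p - 2) : ℝ) : ℂ) * phiD 2 w
        * (w 0 : ℂ) ^ (-k) * ((w 1 : ℂ) ^ k * (w 1 : ℂ)⁻¹) := by
      rw [powTwist, zpow_sub_one₀ h1]
    have e2 : powTwist p (-(k + 1)) k w = ((‖phiD 2 w‖ ^ (p - 2) : ℝ) : ℂ) * phiD 2 w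
        * ((w 0 : ℂ) ^ (-k) * (w 0 : ℂ)⁻¹) * (w 1 : ℂ) ^ k := by
      rw [powTwist, neg_add, ← sub_eq_add_neg, zpow_sub_one₀ h0]
    have e3 : (w 0 : ℂ) ^ (-k - 1) * (w 0 : ℂ) = (w 0 : ℂ) ^ (-k) := by
      rw [zpow_sub_one₀ h0, inv_mul_cancel_right₀ h0]
    simp only [Function.comp_apply, ← hw0, hφw, smul_apply,
      innerSL_apply_apply, smul_eq_mul, Complex.ofReal_mul, hinner]
    rw [← hw1]
    push_cast
    linear_combination (-k * ((‖phiD 2 w‖ ^ p : ℝ) : ℂ) * I * (w 1 : ℂ) ^ k) * e3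
      - k * I * hmul - I * p / 2 * e1 + I * p / 2 * e2

lemma integral_powTwist_recurrence {p : ℝ} (hp : 1 < p) (k : ℤ) :
    ((p : ℂ) / 2 + k) * ∫ z, powTwist p (-(k + 1)) k z ∂muD 2
      = (p / 2 - k) * ∫ z, powTwist p (-k) (k - 1) z ∂muD 2 := by
  set F : (Fin 2 → Circle) → ℂ := fun z =>
    ((‖phiD 2 z‖ ^ p : ℝ) : ℂ) * (z 0 : ℂ) ^ (-k) * (z 1 : ℂ) ^ k with hF
  set H : (Fin 2 → Circle) → ℂ := fun z =>
    I * ((p / 2 - k) * powTwist p (-k) (k - 1) z - (p / 2 + k) * powTwist p (-(k + 1)) k z) with hH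
  have c1 := continuous_powTwist hp (-k) (k - 1)
  have c2 := continuous_powTwist hp (-(k + 1)) k
  have cF : Continuous F := by
    rw [hF, funext (norm_phiD_rpow_mul hp k)]
    exact c1.add c2
  have cH : Continuous H := by fun_prop
  have cmul : ∀ g : Fin 2 → Circle, Continuous fun z => g * z := fun g => continuous_const_mul g
  obtain ⟨C, hC⟩ := isCompact_univ.exists_bound_of_continuousOn cH.continuousOn
  have key := (hasDerivAt_integral_of_dominated_loc_of_deriv_le (μ := muD 2) (x₀ := (0 : ℝ))
    (F := fun s z => F (![Circle.exp s, 1] * z)) (F' := fun s z => H (![Circle.exp s, 1] * z))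
    (bound := fun _ => C) (s := Set.univ) Filter.univ_mem
    (Eventually.of_forall fun s => (integrable_muD_of_continuous (cF.comp (cmul _))).1)
    (integrable_muD_of_continuous (cF.comp (cmul _)))
    (integrable_muD_of_continuous (cH.comp (cmul _))).1
    (Eventually.of_forall fun z s _ => hC _ (Set.mem_univ _)) (integrable_const C)
    (Eventually.of_forall fun z s _ => hasDerivAt_rotation hp k z s)).2
  simp only [integral_mul_left_eq_self] at key
  have hzero : ∫ z, H z ∂muD 2 = 0 := key.unique (hasDerivAt_const _ _)
  have i1 := integrable_muD_of_continuous c1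
  have i2 := integrable_muD_of_continuous c2
  rw [hH, integral_const_mul, integral_sub (i1.const_mul _) (i2.const_mul _),
    integral_const_mul, integral_const_mul] at hzero
  have := (mul_eq_zero.1 hzero).resolve_left I_ne_zero
  linear_combination -this

lemma integral_norm_phiD_rpow_pos {p : ℝ} (hp : 1 < p) :
    0 < ∫ z, ‖phiD 2 z‖ ^ p ∂muD 2 := by
  have hc : Continuous fun z : Fin 2 → Circle => ‖phiD 2 z‖ ^ p :=
    (continuous_phiD 2).norm.rpow_const fun _ => Or.inr (by linarith)
  refine hc.integral_pos_of_hasCompactSupport_nonneg_nonzero (x := 1)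
    (HasCompactSupport.of_compactSpace _) (fun z => by positivity) ?_
  have : phiD 2 1 = 2 := by simp [phiD]
  rw [this]
  exact (Real.rpow_pos_of_pos (by norm_num) p).ne'

lemma integral_norm_phiD_rpow {p : ℝ} (hp : 1 < p) :
    ((∫ z, ‖phiD 2 z‖ ^ p ∂muD 2 : ℝ) : ℂ) = 2 * ∫ z, powTwist p 0 (-1) z ∂muD 2 := by
  have hrec := integral_powTwist_recurrence hp 0
  have hp2 : (p : ℂ) / 2 ≠ 0 := by
    have : (p : ℂ) ≠ 0 := by exact_mod_cast (by linarith : p ≠ 0)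
    simpa using this
  have hrec' : ∫ z, powTwist p (-(0 + 1)) 0 z ∂muD 2 = ∫ z, powTwist p (-0) (0 - 1) z ∂muD 2 := by
    apply mul_left_cancel₀ hp2
    simpa using hrec
  have hfun : ∀ z : Fin 2 → Circle, ((‖phiD 2 z‖ ^ p : ℝ) : ℂ)
      = powTwist p (-0) (0 - 1) z + powTwist p (-(0 + 1)) 0 z := by
    intro z
    rw [← norm_phiD_rpow_mul hp 0 z]
    simp
  rw [← integral_complex_ofReal, integral_congr_ae (Eventually.of_forall hfun),
    integral_add (integrable_muD_of_continuous (continuous_powTwist hp _ _))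
      (integrable_muD_of_continuous (continuous_powTwist hp _ _)), hrec']
  norm_num
  ring

lemma Real.inv_Gamma_eq_self_mul_inv_Gamma_add_one (s : ℝ) :
    (Real.Gamma s)⁻¹ = s * (Real.Gamma (s + 1))⁻¹ := by
  by_cases hs : s = 0
  · simp [hs, Real.Gamma_zero]
  · rw [Real.Gamma_add_one hs, mul_inv, mul_inv_cancel_left₀ hs]

/-- The coefficients `Γ(1+p/2)Γ(p/2)/(Γ(1+p/2-k)Γ(p/2+k))`. -/
noncomputable def gammaCoeff (p : ℝ) (k : ℤ) : ℝ :=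
  Real.Gamma (1 + p / 2) * Real.Gamma (p / 2) * (Real.Gamma (1 + p / 2 - k))⁻¹
    * (Real.Gamma (p / 2 + k))⁻¹

lemma gammaCoeff_zero {p : ℝ} (hp : 0 < p) : gammaCoeff p 0 = 1 := by
  have h1 : Real.Gamma (1 + p / 2) ≠ 0 := (Real.Gamma_pos_of_pos (by positivity)).ne'
  have h2 : Real.Gamma (p / 2) ≠ 0 := (Real.Gamma_pos_of_pos (by positivity)).ne'
  simp only [gammaCoeff, Int.cast_zero, sub_zero, add_zero]
  field_simp

lemma gammaCoeff_recurrence (p : ℝ) (k : ℤ) :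
    (p / 2 + k) * gammaCoeff p (k + 1) = (p / 2 - k) * gammaCoeff p k := by
  have h1 := Real.inv_Gamma_eq_self_mul_inv_Gamma_add_one (p / 2 - k)
  have h2 := Real.inv_Gamma_eq_self_mul_inv_Gamma_add_one (p / 2 + k)
  simp only [gammaCoeff, Int.cast_add, Int.cast_one]
  rw [show 1 + p / 2 - ((k : ℝ) + 1) = p / 2 - k by ring,
    show 1 + p / 2 - (k : ℝ) = p / 2 - k + 1 by ring,
    show p / 2 + ((k : ℝ) + 1) = p / 2 + k + 1 by ring, h1, h2]
  ring

lemma integral_powTwist_eq {p : ℝ} (hp : 1 < p) (k : ℤ) :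
    ∫ z, powTwist p (-k) (k - 1) z ∂muD 2
      = gammaCoeff p k * ∫ z, powTwist p 0 (-1) z ∂muD 2 := by
  have hG : ∀ k : ℤ, ((p : ℂ) / 2 + k) * gammaCoeff p (k + 1)
      = ((p : ℂ) / 2 - k) * gammaCoeff p k := fun k => by
    exact_mod_cast congrArg Complex.ofReal (gammaCoeff_recurrence p k)
  have hJ := fun k : ℤ => integral_powTwist_recurrence hp k
  induction k with
  | zero => simp [gammaCoeff_zero (by linarith : 0 < p)]
  | succ n ih =>
    have hne : (p : ℂ) / 2 + (n : ℤ) ≠ 0 := by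
      have : p / 2 + n ≠ 0 := by positivity
      exact_mod_cast this
    apply mul_left_cancel₀ hne
    rw [add_sub_cancel_right, hJ n, ih, ← mul_assoc, ← mul_assoc, hG n]
  | pred n ih =>
    have hne : (p : ℂ) / 2 - ((-n - 1 : ℤ) : ℂ) ≠ 0 := by
      have : p / 2 + n + 1 ≠ 0 := by positivity
      have h : ((p / 2 + n + 1 : ℝ) : ℂ) ≠ 0 := by exact_mod_cast this
      convert h using 1
      push_cast
      ring
    apply mul_left_cancel₀ hne
    rw [← hJ, ← mul_assoc, ← hG, sub_add_cancel, ih, mul_assoc]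

/-- the Fourier coefficients of `ψ = 2‖z_1+z_2‖_p^{-p} |z_1+z_2|^{p-2}(z_1+z_2)`
on `𝕋²`: for every `k ∈ ℤ`,
`∫ ψ(z) conj(z_1)^k conj(z_2)^{1-k} dμ_2 = Γ(1+p/2)Γ(p/2)/(Γ(1+p/2-k)Γ(p/2+k))`,
with the convention `1/Γ = 0` at nonpositive integers. -/
theorem psi_fourier_two_vars (p : ℝ) (hp : 1 < p) (k : ℤ) :
    ∫ z : Fin 2 → Circle,
        psiFn p 2 z * ((starRingEnd ℂ) ((z 0 : ℂ))) ^ k * ((starRingEnd ℂ) ((z 1 : ℂ))) ^ (1 - k)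
          ∂muD 2
      = ((Real.Gamma (1 + p / 2) * Real.Gamma (p / 2) * (Real.Gamma (1 + p / 2 - k))⁻¹
          * (Real.Gamma (p / 2 + k))⁻¹ : ℝ) : ℂ) := by
  have hX := integral_norm_phiD_rpow_pos hp
  have hX2 := integral_norm_phiD_rpow hp
  have hnorm : phiNorm p 2 ^ (-p) = (∫ z, ‖phiD 2 z‖ ^ p ∂muD 2)⁻¹ := by
    rw [phiNorm, ← Real.rpow_mul hX.le,
      show 1 / p * -p = -1 by field_simp, Real.rpow_neg_one]
  have hfun : ∀ z : Fin 2 → Circle, psiFn p 2 z * ((starRingEnd ℂ) ((z 0 : ℂ))) ^ k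
      * ((starRingEnd ℂ) ((z 1 : ℂ))) ^ (1 - k)
      = ((2 * phiNorm p 2 ^ (-p) : ℝ) : ℂ) * powTwist p (-k) (k - 1) z := by
    intro z
    rw [← Circle.coe_inv_eq_conj, ← Circle.coe_inv_eq_conj, Circle.coe_inv, Circle.coe_inv,
      inv_zpow', inv_zpow', neg_sub, psiFn, powTwist]
    push_cast
    ring
  have hne : ((∫ z, ‖phiD 2 z‖ ^ p ∂muD 2 : ℝ) : ℂ) ≠ 0 := by exact_mod_cast hX.ne'
  rw [integral_congr_ae (Eventually.of_forall hfun), integral_const_mul, hnorm,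
    integral_powTwist_eq hp, ← gammaCoeff]
  push_cast
  rw [hX2] at hne ⊢
  field_simp [right_ne_zero_of_mul hne]
end
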